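/- Let φ be an injective ℂ-algebra endomorphism of ℂ[x,y] which is not an automorphism. If φ(p) = p for some non-constant polynomial p ∈ ℂ[x,y], then p ∈ ℂ[q] for some coordinate polynomial q of ℂ[x,y], i.e., p is a polynomial in a single coordinate polynomial q. -/

import Mathlib

open MvPolynomial

/-- `ℂ[x,y]` as multivariate polynomials in two variables. -/
local notation "P" => MvPolynomial (Fin 2) ℂ

/-- A coordinate polynomial: one taken to `x` by some `ℂ`-algebra automorphism. -/
def IsCoordinate (q : P) : Prop :=
  ∃ α : P ≃ₐ[ℂ] P, α q = X 0

/-- The derivation `b ↦ J(a, b)` sending `b` to its Jacobian determinant with `a`. -/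
noncomputable def jacobianDerivation (a : P) : Derivation ℂ P P :=
  pderiv 0 a • pderiv 1 - pderiv 1 a • pderiv 0

theorem jacobianDerivation_apply (a b : P) :
    jacobianDerivation a b = pderiv 0 a * pderiv 1 b - pderiv 1 a * pderiv 0 b := by
  simp [jacobianDerivation]

theorem derivation_algHom_apply {S : Type*} [CommRing S] [Algebra ℂ S] (δ : Derivation ℂ S S)
    (Θ : P →ₐ[ℂ] S) (a : P) :
    δ (Θ a) = Θ (pderiv 0 a) * δ (Θ (X 0)) + Θ (pderiv 1 a) * δ (Θ (X 1)) := by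
  induction a using MvPolynomial.induction_on with
  | C r =>
    have : Θ (C r) = algebraMap ℂ S r := Θ.commutes r
    simp [this]
  | add p q hp hq => simp only [map_add, hp, hq]; ring
  | mul_X p i hp =>
    fin_cases i
    · simp [Derivation.leibniz, hp, pderiv_X]; ring
    · simp [Derivation.leibniz, hp, pderiv_X]; ring

theorem jacobianDerivation_algHom (ψ : P →ₐ[ℂ] P) (a b : P) :
    jacobianDerivation (ψ a) (ψ b) =
      jacobianDerivation (ψ (X 0)) (ψ (X 1)) * ψ (jacobianDerivation a b) := by
  simp only [jacobianDerivation_apply, map_sub, map_mul,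
    derivation_algHom_apply (pderiv 0) ψ a, derivation_algHom_apply (pderiv 1) ψ a,
    derivation_algHom_apply (pderiv 0) ψ b, derivation_algHom_apply (pderiv 1) ψ b]
  ring

theorem derivation_eq_zero_of_isAlgebraic {A : Subalgebra ℂ P} [Algebra.IsAlgebraic A P]
    (d : Derivation ℂ P P) (h : ∀ a ∈ A, d a = 0) (b : P) : d b = 0 := by
  classical
  let d' : Derivation A P P := Derivation.mk'
    { toFun := d
      map_add' := d.map_add
      map_smul' := fun a b => by
        simp [Algebra.smul_def, Derivation.leibniz, h _ a.2] } (fun a b => d.leibniz a b)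
  have hd' : ∀ b, d' b = d b := fun _ => rfl
  have hex : ∃ n, ∃ F : Polynomial A, F ≠ 0 ∧ Polynomial.aeval b F = 0 ∧ F.natDegree = n := by
    obtain ⟨F, h0, hF⟩ := Algebra.IsAlgebraic.isAlgebraic (R := A) b
    exact ⟨_, F, h0, hF, rfl⟩
  obtain ⟨F, hF0, hF, hdeg⟩ := Nat.find_spec hex
  have hpos : 0 < F.natDegree := by
    by_contra hcon
    obtain ⟨c, rfl⟩ := Polynomial.natDegree_eq_zero.1 (by omega : F.natDegree = 0)
    rw [Polynomial.aeval_C] at hF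
    apply hF0
    rw [show c = 0 from Subtype.ext hF, Polynomial.C_0]
  have hder : Polynomial.aeval b F.derivative * d b = 0 := by
    have := Derivation.map_aeval d' F b
    rw [hF, map_zero, hd'] at this
    simpa using this.symm
  rcases mul_eq_zero.1 hder with h1 | h1
  · exfalso
    refine Nat.find_min hex (m := F.derivative.natDegree) ?_ ⟨_, ?_, h1, rfl⟩
    · rw [← hdeg]; exact Polynomial.natDegree_derivative_lt hpos.ne'
    · intro h2
      have := Polynomial.derivative_eq_zero.1 h2
      omega
  · exact h1

theorem isAlgebraic_range_of_injective {ψ : P →ₐ[ℂ] P} (hψ : Function.Injective ψ) :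
    Algebra.IsAlgebraic ψ.range P := by
  have h1 : AlgebraicIndependent ℂ (fun i => ψ (X i)) :=
    (MvPolynomial.algebraicIndependent_X (Fin 2) ℂ).map' hψ
  have h2 : IsTranscendenceBasis ℂ (fun i => ψ (X i)) := by
    refine h1.isTranscendenceBasis_of_trdeg_le_of_finite ?_
    simp [MvPolynomial.trdeg_of_isDomain]
  have h3 := h2.isAlgebraic
  have h4 : Algebra.adjoin ℂ (Set.range fun i => ψ (X i)) = ψ.range := by
    rw [show (Set.range fun i => ψ (X i)) = ψ '' Set.range X by rw [← Set.range_comp]; rfl,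
      ← AlgHom.map_adjoin, MvPolynomial.adjoin_range_X, Algebra.map_top]
  rwa [h4] at h3

theorem jacobianDerivation_ne_zero {ψ : P →ₐ[ℂ] P} (hψ : Function.Injective ψ) :
    jacobianDerivation (ψ (X 0)) (ψ (X 1)) ≠ 0 := by
  intro h
  have := isAlgebraic_range_of_injective hψ
  have hker : ∀ a b, jacobianDerivation (ψ a) b = 0 := fun a b =>
    derivation_eq_zero_of_isAlgebraic (A := ψ.range) _ (by
      rintro _ ⟨b, rfl⟩
      simpa [h] using jacobianDerivation_algHom ψ a b) b
  have h0 := hker (X 0) (X 0)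
  have h1 := hker (X 0) (X 1)
  simp [jacobianDerivation_apply, pderiv_X] at h0 h1
  have hcoeff : ∀ i, pderiv i (ψ (X 0)) = 0 := Fin.forall_fin_two.2 ⟨h1, h0⟩
  have hC : ψ (X 0) = C (coeff 0 (ψ (X 0))) := by
    ext m
    rw [coeff_C]
    split_ifs with hm
    · rw [hm]
    · obtain ⟨i, hi⟩ : ∃ i, m i ≠ 0 := by
        by_contra! hcon
        exact hm (Finsupp.ext fun i => (hcon i).symm)
      have h2 := congrArg (coeff (m - Finsupp.single i 1)) (hcoeff i)
      rw [coeff_pderiv, tsub_add_cancel_of_le (by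
        rw [Finsupp.single_le_iff]; omega), coeff_zero] at h2
      exact (mul_eq_zero.1 h2).resolve_right (by norm_cast)
  have hX : (X 0 : P) = C (coeff 0 (ψ (X 0))) := hψ (by rw [hC]; simp)
  have := congrArg totalDegree hX
  simp at this

theorem totalDegree_pderiv_le (i : Fin 2) (a : P) : (pderiv i a).totalDegree ≤ a.totalDegree := by
  refine Finset.sup_le fun d hd => ?_
  rw [mem_support_iff, coeff_pderiv] at hd
  have h := le_totalDegree (mem_support_iff.2 (left_ne_zero_of_mul hd))
  rw [Finsupp.sum_add_index' (by simp) (by simp)] at h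
  exact (Nat.le_add_right _ _).trans h

theorem totalDegree_jacobianDerivation_le (a b : P) :
    (jacobianDerivation a b).totalDegree ≤ a.totalDegree + b.totalDegree := by
  rw [jacobianDerivation_apply]
  refine (totalDegree_sub _ _).trans (max_le ?_ ?_) <;>
    exact (totalDegree_mul _ _).trans
      (add_le_add (totalDegree_pderiv_le _ _) (totalDegree_pderiv_le _ _))

theorem totalDegree_map_jacobianDerivation_le {ψ : P →ₐ[ℂ] P} (hψ : Function.Injective ψ) {p : P}
    (hfix : ψ p = p) (b : P) :
    (ψ (jacobianDerivation p b)).totalDegree ≤ p.totalDegree + (ψ b).totalDegree := by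
  by_cases h0 : ψ (jacobianDerivation p b) = 0
  · simp [h0]
  have h := jacobianDerivation_algHom ψ p b
  rw [hfix] at h
  have h1 := totalDegree_jacobianDerivation_le p (ψ b)
  rw [h, totalDegree_mul_of_isDomain (jacobianDerivation_ne_zero hψ) h0] at h1
  omega

theorem totalDegree_map_iterate_jacobianDerivation_le {ψ : P →ₐ[ℂ] P}
    (hψ : Function.Injective ψ) {p : P} (hfix : ψ p = p) (b : P) (i : ℕ) :
    (ψ ((jacobianDerivation p)^[i] b)).totalDegree ≤ i * p.totalDegree + (ψ b).totalDegree := by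
  induction i with
  | zero => simp
  | succ i ih =>
    rw [Function.iterate_succ_apply']
    refine (totalDegree_map_jacobianDerivation_le hψ hfix _).trans ?_
    rw [add_one_mul]
    omega

theorem exists_linear_relation_of_totalDegree_le {ι : Type*} [Fintype ι] (v : ι → P) (d : ℕ)
    (hv : ∀ i, (v i).totalDegree ≤ d) (hd : (d + 1) ^ 2 < Fintype.card ι) :
    ∃ c : ι → ℂ, c ≠ 0 ∧ ∑ i, c i • v i = 0 := by
  let e : Fin (d + 1) × Fin (d + 1) → (Fin 2 →₀ ℕ) := fun ij =>
    Finsupp.single 0 (ij.1 : ℕ) + Finsupp.single 1 (ij.2 : ℕ)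
  let f : (ι → ℂ) →ₗ[ℂ] (Fin (d + 1) × Fin (d + 1) → ℂ) :=
    (LinearMap.pi fun ij => lcoeff ℂ (e ij)) ∘ₗ Fintype.linearCombination ℂ v
  have hf : LinearMap.ker f ≠ ⊥ := LinearMap.ker_ne_bot_of_finrank_lt (by
    simpa [pow_two] using hd)
  obtain ⟨c, hc, hc0⟩ := (Submodule.ne_bot_iff _).1 hf
  refine ⟨c, hc0, ?_⟩
  ext m
  rw [coeff_zero]
  by_cases hm : d < m 0 + m 1
  · refine coeff_eq_zero_of_totalDegree_lt (lt_of_le_of_lt (b := d) ?_ ?_)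
    · exact totalDegree_finsetSum_le fun i _ => (totalDegree_smul_le _ _).trans (hv i)
    · have : m.degree = m 0 + m 1 := by
        rw [Finsupp.degree_eq_sum]; simp
      rw [Finsupp.degree] at this
      exact hm.trans_eq this.symm
  · have h := congrFun (LinearMap.mem_ker.1 hc) (⟨m 0, by omega⟩, ⟨m 1, by omega⟩)
    have he : e (⟨m 0, by omega⟩, ⟨m 1, by omega⟩) = m := by
      ext i
      fin_cases i <;> simp [e]
    simp only [f, LinearMap.comp_apply, LinearMap.pi_apply, he, lcoeff_apply,
      Fintype.linearCombination_apply, Pi.zero_apply] at h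
    exact h

theorem exists_bivariate_relation (p z : P) : ∃ n : ℕ, ∀ b : Fin n → P,
    ∃ (M : ℕ) (a : Fin n → ℕ → Polynomial ℂ), (∃ i, a i M ≠ 0) ∧
      ∑ l ∈ Finset.range (M + 1), ∑ i, Polynomial.aeval p (a i l) * z ^ l * b i = 0 := by
  set K := p.totalDegree + z.totalDegree
  refine ⟨(K + 1) ^ 2, fun b => ?_⟩
  set e := Finset.univ.sup fun i => (b i).totalDegree
  set T := e + 1
  obtain ⟨c, hc0, hc⟩ := exists_linear_relation_of_totalDegree_le
    (fun k : Fin ((K + 1) ^ 2) × Fin (T + 1) × Fin (T + 1) =>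
      p ^ (k.2.2 : ℕ) * z ^ (k.2.1 : ℕ) * b k.1) (T * K + e) (by
      rintro ⟨i, l, j⟩
      have hi : (b i).totalDegree ≤ e := Finset.le_sup (f := fun i => (b i).totalDegree)
        (Finset.mem_univ i)
      refine (totalDegree_mul _ _).trans (add_le_add ((totalDegree_mul _ _).trans ?_) hi)
      rw [mul_add]
      exact add_le_add
        ((totalDegree_pow _ _).trans (Nat.mul_le_mul_right _ (Nat.lt_succ_iff.1 j.2)))
        ((totalDegree_pow _ _).trans (Nat.mul_le_mul_right _ (Nat.lt_succ_iff.1 l.2)))) (by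
      simp only [Fintype.card_prod, Fintype.card_fin]
      have : T * K + e + 1 = T * (K + 1) := by simp only [T]; ring
      rw [this]
      have : (T * (K + 1)) ^ 2 = (K + 1) ^ 2 * (T * T) := by ring
      rw [this]
      exact Nat.mul_lt_mul_of_pos_left (by nlinarith) (by positivity))
  let a : Fin ((K + 1) ^ 2) → ℕ → Polynomial ℂ := fun i l =>
    if hl : l < T + 1 then ∑ j : Fin (T + 1), Polynomial.monomial j (c (i, ⟨l, hl⟩, j)) else 0
  have ha : ∀ i (l : Fin (T + 1)),
      a i l = ∑ j : Fin (T + 1), Polynomial.monomial j (c (i, l, j)) := fun i l => by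
    simp only [a, l.2, dif_pos, Fin.eta]
  have hrel : ∑ l ∈ Finset.range (T + 1), ∑ i, Polynomial.aeval p (a i l) * z ^ l * b i = 0 := by
    rw [Finset.sum_range, Finset.sum_comm, ← hc, Fintype.sum_prod_type]
    refine Finset.sum_congr rfl fun i _ => ?_
    rw [Fintype.sum_prod_type]
    refine Finset.sum_congr rfl fun l _ => ?_
    rw [ha, map_sum, Finset.sum_mul, Finset.sum_mul]
    refine Finset.sum_congr rfl fun j _ => ?_
    rw [Polynomial.aeval_monomial, Algebra.smul_def]
    ring
  have hex : ∃ l, l ≤ T ∧ ∃ i, a i l ≠ 0 := by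
    by_contra! hcon
    refine hc0 (funext fun ⟨i, l, j⟩ => ?_)
    have h := congrArg (fun q => q.coeff (j : ℕ)) (hcon l (Nat.lt_succ_iff.1 l.2) i)
    simpa [ha, Polynomial.coeff_monomial, Fin.val_inj] using h
  classical
  obtain ⟨l₀, hl₀, hl₀'⟩ := hex
  let q : ℕ → Prop := fun l => ∃ i, a i l ≠ 0
  have hM : q (Nat.findGreatest q T) := Nat.findGreatest_spec hl₀ hl₀'
  refine ⟨Nat.findGreatest q T, a, hM, ?_⟩
  rw [← hrel]
  refine Finset.sum_subset (Finset.range_subset_range.2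
    (Nat.succ_le_succ (Nat.findGreatest_le T))) fun l hl hl' => ?_
  refine Finset.sum_eq_zero fun i _ => ?_
  have : a i l = 0 := by
    by_contra hcon
    simp only [Finset.mem_range, not_lt] at hl hl'
    exact Nat.findGreatest_is_greatest hl' (Nat.lt_succ_iff.1 hl) ⟨i, hcon⟩
  simp [this]

theorem totalDegree_pow_eq {f : P} (hf : f ≠ 0) (n : ℕ) :
    (f ^ n).totalDegree = n * f.totalDegree := by
  induction n with
  | zero => simp
  | succ n ih => rw [pow_succ, totalDegree_mul_of_isDomain (pow_ne_zero _ hf) hf, ih, add_one_mul]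

theorem algHom_aeval_of_fixed {ψ : P →ₐ[ℂ] P} {p : P} (hfix : ψ p = p) (a : Polynomial ℂ) :
    ψ (Polynomial.aeval p a) = Polynomial.aeval p a := by
  rw [← Polynomial.aeval_algHom_apply, hfix]

theorem exists_combination_totalDegree_le (p z : P) (hz : z ≠ 0) : ∃ n : ℕ, ∀ b : Fin n → P,
    ∃ a : Fin n → Polynomial ℂ, a ≠ 0 ∧ ∃ K : ℕ, ∀ (ψ : P →ₐ[ℂ] P), Function.Injective ψ →
      ψ p = p → ∀ R : ℕ, (∀ i, (ψ (b i)).totalDegree ≤ R) →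
      ∑ i, Polynomial.aeval p (a i) * b i ≠ 0 →
      (ψ (∑ i, Polynomial.aeval p (a i) * b i)).totalDegree + (ψ z).totalDegree ≤ R + K := by
  obtain ⟨n, hn⟩ := exists_bivariate_relation p z
  refine ⟨n, fun b => ?_⟩
  obtain ⟨M, a, ⟨i₀, hi₀⟩, hrel⟩ := hn b
  set K := (Finset.range M).sup fun l => Finset.univ.sup fun i =>
    (Polynomial.aeval p (a i l)).totalDegree
  refine ⟨fun i => a i M, fun h => hi₀ (congrFun h i₀), K, fun ψ hψ hfix R hR hne => ?_⟩
  set s := ∑ i, Polynomial.aeval p (a i M) * b i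
  have hlead : ψ z ^ M * ψ s =
      -∑ l ∈ Finset.range M, ∑ i, Polynomial.aeval p (a i l) * ψ z ^ l * ψ (b i) := by
    have h := congrArg ψ hrel
    simp only [map_sum, map_mul, map_pow, map_zero, algHom_aeval_of_fixed hfix] at h
    rw [Finset.sum_range_succ] at h
    rw [eq_neg_iff_add_eq_zero, add_comm, ← h, add_right_inj]
    simp only [s, map_sum, map_mul, algHom_aeval_of_fixed hfix, Finset.mul_sum]
    exact Finset.sum_congr rfl fun i _ => by ring
  have hs : ψ s ≠ 0 := (map_ne_zero_iff ψ hψ).2 hne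
  have hz' : ψ z ≠ 0 := (map_ne_zero_iff ψ hψ).2 hz
  rcases M with _ | M
  · simp [hs] at hlead
  have hdeg := congrArg totalDegree hlead
  rw [totalDegree_mul_of_isDomain (pow_ne_zero _ hz') hs, totalDegree_neg,
    totalDegree_pow_eq hz'] at hdeg
  have hle : (∑ l ∈ Finset.range (M + 1), ∑ i,
      Polynomial.aeval p (a i l) * ψ z ^ l * ψ (b i)).totalDegree ≤
      K + M * (ψ z).totalDegree + R := by
    refine totalDegree_finsetSum_le fun l hl => totalDegree_finsetSum_le fun i _ => ?_
    refine (totalDegree_mul _ _).trans (add_le_add ((totalDegree_mul _ _).trans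
      (add_le_add ?_ ((totalDegree_pow _ _).trans (Nat.mul_le_mul_right _ ?_)))) (hR i))
    · exact (Finset.le_sup (f := fun i => (Polynomial.aeval p (a i l)).totalDegree)
        (Finset.mem_univ i)).trans (Finset.le_sup (f := fun l => Finset.univ.sup fun i =>
          (Polynomial.aeval p (a i l)).totalDegree) hl)
    · exact Nat.lt_succ_iff.1 (Finset.mem_range.1 hl)
  rw [add_one_mul] at hdeg
  omega

theorem mem_range_of_totalDegree_bounded {φ : P →ₐ[ℂ] P} (hφ : Function.Injective φ) (z : P)
    (B : ℕ) (hB : ∀ k : ℕ, ((φ ^ k) z).totalDegree ≤ B) : z ∈ φ.range := by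
  let V : Submodule ℂ P := Submodule.span ℂ (Set.range fun k : ℕ => (φ ^ k) z)
  have hV : V ≤ restrictTotalDegree (Fin 2) ℂ B := by
    refine Submodule.span_le.2 ?_
    rintro _ ⟨k, rfl⟩
    exact (mem_restrictTotalDegree _ _ _).2 (hB k)
  have : FiniteDimensional ℂ V := Submodule.finiteDimensional_of_le hV
  have hmap : ∀ b ∈ V, φ.toLinearMap b ∈ V := by
    intro b hb
    have : V.map φ.toLinearMap ≤ V := by
      rw [Submodule.map_span_le]
      rintro _ ⟨k, rfl⟩
      refine Submodule.subset_span ⟨k + 1, ?_⟩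
      simp [pow_succ']
    exact this (Submodule.mem_map_of_mem hb)
  have hinj : Function.Injective (φ.toLinearMap.restrict hmap) := by
    intro u v huv
    exact Subtype.ext (hφ (congrArg Subtype.val huv))
  obtain ⟨b, hb⟩ := LinearMap.injective_iff_surjective.1 hinj
    ⟨z, Submodule.subset_span ⟨0, by simp⟩⟩
  exact ⟨b, congrArg Subtype.val hb⟩

theorem not_totalDegree_bounded {φ : P →ₐ[ℂ] P} (hφ : Function.Injective φ)
    (hsurj : ¬Function.Surjective φ) (B : ℕ)
    (hB : ∀ i, ∀ k : ℕ, ((φ ^ k) (X i)).totalDegree ≤ B) : False := by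
  refine hsurj (AlgHom.range_eq_top φ |>.1 (top_le_iff.1 ?_))
  rw [← MvPolynomial.adjoin_range_X, Algebra.adjoin_le_iff]
  rintro _ ⟨i, rfl⟩
  exact mem_range_of_totalDegree_bounded hφ _ B (hB i)

theorem algHom_pow_injective {φ : P →ₐ[ℂ] P} (hφ : Function.Injective φ) (k : ℕ) :
    Function.Injective (φ ^ k : P →ₐ[ℂ] P) := by
  rw [AlgHom.coe_pow]; exact hφ.iterate k

theorem algHom_pow_fixed {φ : P →ₐ[ℂ] P} {p : P} (hfix : φ p = p) (k : ℕ) : (φ ^ k) p = p := by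
  rw [AlgHom.coe_pow]; exact Function.iterate_fixed hfix k

theorem exists_unbounded_variable {φ : P →ₐ[ℂ] P} (hφ : Function.Injective φ)
    (hsurj : ¬Function.Surjective φ) : ∃ (j : Fin 2) (B : ℕ),
      (∀ k : ℕ, ((φ ^ k) (X 0)).totalDegree ≤ ((φ ^ k) (X j)).totalDegree + B) ∧
      ∀ K : ℕ, ∃ k : ℕ, K < ((φ ^ k) (X j)).totalDegree := by
  by_cases h : ∀ K : ℕ, ∃ k : ℕ, K < ((φ ^ k) (X 0)).totalDegree
  · exact ⟨0, 0, fun k => le_rfl, h⟩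
  push Not at h
  obtain ⟨B, hB⟩ := h
  refine ⟨1, B, fun k => (hB k).trans (Nat.le_add_left _ _), ?_⟩
  by_contra! hcon
  obtain ⟨K, hK⟩ := hcon
  refine not_totalDegree_bounded hφ hsurj (max B K) ?_
  exact Fin.forall_fin_two.2 ⟨fun k => le_max_of_le_left (hB k), fun k => le_max_of_le_right (hK k)⟩

theorem exists_iterate_relation {φ : P →ₐ[ℂ] P} (hφ : Function.Injective φ)
    (hsurj : ¬Function.Surjective φ) {p : P} (hfix : φ p = p) :
    ∃ (N : ℕ) (a : Fin N → Polynomial ℂ), a ≠ 0 ∧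
      ∑ i, Polynomial.aeval p (a i) * (jacobianDerivation p)^[i] (X 0) = 0 := by
  obtain ⟨j, B, hB, hunb⟩ := exists_unbounded_variable hφ hsurj
  obtain ⟨n, hn⟩ := exists_combination_totalDegree_le p (X j) (X_ne_zero j)
  choose a ha K hK using fun u : Fin n =>
    hn fun v => (jacobianDerivation p)^[finProdFinEquiv (u, v)] (X 0)
  set s : Fin n → P := fun u => ∑ v, Polynomial.aeval p (a u v) *
    (jacobianDerivation p)^[finProdFinEquiv (u, v)] (X 0)
  have hs : ∀ k u, ((φ ^ k) (s u)).totalDegree ≤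
      B + n * n * p.totalDegree + Finset.univ.sup K := by
    intro k u
    by_cases h0 : s u = 0
    · simp [h0]
    have h := hK u (φ ^ k) (algHom_pow_injective hφ k) (algHom_pow_fixed hfix k)
      (n * n * p.totalDegree + (((φ ^ k) (X j)).totalDegree + B)) (fun v =>
        (totalDegree_map_iterate_jacobianDerivation_le (algHom_pow_injective hφ k)
          (algHom_pow_fixed hfix k) _ _).trans
            (add_le_add (Nat.mul_le_mul_right _ (finProdFinEquiv (u, v)).2.le) (hB k))) h0
    have h' : K u ≤ Finset.univ.sup K := Finset.le_sup (Finset.mem_univ u)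
    change ((φ ^ k) (s u)).totalDegree + _ ≤ _ at h
    omega
  obtain ⟨a', ha', K', hK'⟩ := hn s
  have hzero : ∑ u, Polynomial.aeval p (a' u) * s u = 0 := by
    by_contra h0
    obtain ⟨k, hk⟩ := hunb (B + n * n * p.totalDegree + Finset.univ.sup K + K')
    have h := hK' (φ ^ k) (algHom_pow_injective hφ k) (algHom_pow_fixed hfix k) _ (hs k) h0
    omega
  refine ⟨n * n, fun i => a' (finProdFinEquiv.symm i).1 *
    a (finProdFinEquiv.symm i).1 (finProdFinEquiv.symm i).2, fun h => ?_, ?_⟩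
  · obtain ⟨u, hu⟩ := Function.ne_iff.1 ha'
    obtain ⟨v, hv⟩ := Function.ne_iff.1 (ha u)
    have := congrFun h (finProdFinEquiv (u, v))
    simp only [Equiv.symm_apply_apply] at this
    exact mul_ne_zero hu hv this
  · rw [← hzero, ← finProdFinEquiv.sum_comp, Fintype.sum_prod_type]
    refine Finset.sum_congr rfl fun u _ => ?_
    rw [Finset.mul_sum]
    refine Finset.sum_congr rfl fun v _ => ?_
    simp only [Equiv.symm_apply_apply, map_mul, mul_assoc]

/-- The exponent vector of `x ^ a * y ^ e`. -/
noncomputable def bidegree (a e : ℕ) : Fin 2 →₀ ℕ := Finsupp.single 0 a + Finsupp.single 1 e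

@[simp] theorem bidegree_zero_apply (a e : ℕ) : bidegree a e 0 = a := by simp [bidegree]

@[simp] theorem bidegree_one_apply (a e : ℕ) : bidegree a e 1 = e := by simp [bidegree]

theorem eq_bidegree (m : Fin 2 →₀ ℕ) : m = bidegree (m 0) (m 1) := by
  ext i; fin_cases i <;> simp

theorem eq_bidegree_iff {m : Fin 2 →₀ ℕ} {a e : ℕ} : m = bidegree a e ↔ m 0 = a ∧ m 1 = e := by
  constructor
  · rintro rfl; simp
  · rintro ⟨rfl, rfl⟩; exact eq_bidegree m

theorem bidegree_add (a e a' e' : ℕ) :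
    bidegree a e + bidegree a' e' = bidegree (a + a') (e + e') := by
  rw [eq_bidegree_iff]; simp

/-- With monomials ordered by larger `x`-degree first and then by smaller `y`-degree, no monomial
of `F` exceeds `x ^ a * y ^ e`, whose coefficient in `F` is `c`. -/
def HasLeading (F : P) (a e : ℕ) (c : ℂ) : Prop :=
  (∀ m, coeff m F ≠ 0 → m 0 < a ∨ m 0 = a ∧ e ≤ m 1) ∧ coeff (bidegree a e) F = c

namespace HasLeading

theorem of_lt {F : P} {a e a' e' : ℕ} {c : ℂ} (h : HasLeading F a e c)
    (hlt : a < a' ∨ a = a' ∧ e' < e) : HasLeading F a' e' 0 := by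
  refine ⟨fun m hm => ?_, ?_⟩
  · have := h.1 m hm
    omega
  · by_contra hm
    have := h.1 _ hm
    simp only [bidegree_zero_apply, bidegree_one_apply] at this
    omega

theorem add {F G : P} {a e : ℕ} {c c' : ℂ} (hF : HasLeading F a e c) (hG : HasLeading G a e c') :
    HasLeading (F + G) a e (c + c') := by
  refine ⟨fun m hm => ?_, by rw [coeff_add, hF.2, hG.2]⟩
  rw [coeff_add] at hm
  by_cases h : coeff m F = 0
  · exact hG.1 m (by simpa [h] using hm)
  · exact hF.1 m h

theorem C_mul {F : P} {a e : ℕ} {c : ℂ} (hF : HasLeading F a e c) (r : ℂ) :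
    HasLeading (C r * F) a e (r * c) := by
  refine ⟨fun m hm => hF.1 m ?_, by rw [coeff_C_mul, hF.2]⟩
  rw [coeff_C_mul] at hm
  exact right_ne_zero_of_mul hm

theorem sub {F G : P} {a e : ℕ} {c c' : ℂ} (hF : HasLeading F a e c) (hG : HasLeading G a e c') :
    HasLeading (F - G) a e (c - c') := by
  have := hF.add (hG.C_mul (-1))
  simpa [sub_eq_add_neg] using this

theorem zero (a e : ℕ) : HasLeading 0 a e 0 := ⟨fun m hm => absurd (coeff_zero m) hm, coeff_zero _⟩

theorem sum {ι : Type*} (s : Finset ι) {F : ι → P} {a e : ℕ} {c : ι → ℂ}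
    (h : ∀ i ∈ s, HasLeading (F i) a e (c i)) : HasLeading (∑ i ∈ s, F i) a e (∑ i ∈ s, c i) := by
  classical
  induction s using Finset.induction_on with
  | empty => exact zero a e
  | insert i s hi ih =>
    rw [Finset.sum_insert hi, Finset.sum_insert hi]
    exact (h i (Finset.mem_insert_self i s)).add
      (ih fun j hj => h j (Finset.mem_insert_of_mem hj))

theorem mul {F G : P} {a e a' e' : ℕ} {c c' : ℂ} (hF : HasLeading F a e c)
    (hG : HasLeading G a' e' c') : HasLeading (F * G) (a + a') (e + e') (c * c') := by
  classical
  constructor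
  · intro m hm
    rw [coeff_mul] at hm
    obtain ⟨⟨u, v⟩, huv, hne⟩ := Finset.exists_ne_zero_of_sum_ne_zero hm
    have h1 := hF.1 u (left_ne_zero_of_mul hne)
    have h2 := hG.1 v (right_ne_zero_of_mul hne)
    rw [Finset.HasAntidiagonal.mem_antidiagonal] at huv
    subst huv
    simp only [Finsupp.add_apply]
    omega
  · rw [coeff_mul, Finset.sum_eq_single (bidegree a e, bidegree a' e')]
    · rw [hF.2, hG.2]
    · rintro ⟨u, v⟩ huv hne
      by_contra h0
      have h1 := hF.1 u (left_ne_zero_of_mul h0)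
      have h2 := hG.1 v (right_ne_zero_of_mul h0)
      rw [Finset.HasAntidiagonal.mem_antidiagonal] at huv
      have e0 := DFunLike.congr_fun huv 0
      have e1 := DFunLike.congr_fun huv 1
      simp only [Finsupp.add_apply, bidegree_zero_apply, bidegree_one_apply] at e0 e1
      refine hne (Prod.ext ?_ ?_) <;> rw [eq_bidegree_iff] <;> dsimp only <;> omega
    · intro h
      exact absurd (Finset.HasAntidiagonal.mem_antidiagonal.2 (bidegree_add a e a' e')) h

theorem one : HasLeading 1 0 0 1 := by
  classical
  have h0 : bidegree 0 0 = 0 := by simp [bidegree]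
  refine ⟨fun m hm => ?_, by simp [h0]⟩
  rw [coeff_one] at hm
  have : m = 0 := by by_contra h; exact hm (if_neg (Ne.symm h))
  simp [this]

theorem pow {F : P} {a e : ℕ} {c : ℂ} (hF : HasLeading F a e c) (n : ℕ) :
    HasLeading (F ^ n) (n * a) (n * e) (c ^ n) := by
  induction n with
  | zero => simpa using one
  | succ n ih => simpa only [pow_succ, add_one_mul] using ih.mul hF

theorem X_mul_pderiv {F : P} {a e : ℕ} {c : ℂ} (hF : HasLeading F a e c) (i : Fin 2) :
    HasLeading (X i * pderiv i F) a e (bidegree a e i * c) := by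
  have hc : ∀ m, coeff m (X i * pderiv i F) = m i * coeff m F := by
    intro m
    rw [coeff_X_mul']
    split_ifs with hi
    · rw [Finsupp.mem_support_iff] at hi
      rw [coeff_pderiv, tsub_add_cancel_of_le (by rw [Finsupp.single_le_iff]; omega)]
      rw [Finsupp.tsub_apply, Finsupp.single_eq_same, mul_comm]
      congr 1
      norm_cast
      omega
    · rw [Finsupp.notMem_support_iff] at hi
      simp [hi]
  refine ⟨fun m hm => hF.1 m ?_, by rw [hc, hF.2]⟩
  rw [hc] at hm
  exact right_ne_zero_of_mul hm

theorem jacobian {F G : P} {a e a' e' : ℕ} {c c' : ℂ} (hF : HasLeading F a e c)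
    (hG : HasLeading G a' e' c') :
    HasLeading (X 0 * X 1 * jacobianDerivation F G) (a + a') (e + e')
      (c * c' * (a * e' - e * a')) := by
  have h := ((hF.X_mul_pderiv 0).mul (hG.X_mul_pderiv 1)).sub
    ((hF.X_mul_pderiv 1).mul (hG.X_mul_pderiv 0))
  simp only [bidegree_zero_apply, bidegree_one_apply] at h
  convert h using 1
  · rw [jacobianDerivation_apply]; ring
  · ring

theorem of_monomial_mul {F : P} {a e s t : ℕ} {c r : ℂ} (hr : r ≠ 0)
    (h : HasLeading (monomial (bidegree s t) r * F) (a + s) (e + t) c) :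
    HasLeading F a e (r⁻¹ * c) := by
  constructor
  · intro m hm
    have := h.1 (bidegree s t + m) (by rw [coeff_monomial_mul]; exact mul_ne_zero hr hm)
    simp only [Finsupp.add_apply, bidegree_zero_apply, bidegree_one_apply] at this
    omega
  · rw [← h.2, add_comm a, add_comm e, ← bidegree_add, coeff_monomial_mul, inv_mul_cancel_left₀ hr]

end HasLeading

/-- The homomorphism `x ↦ x ^ w₁`, `y ↦ x ^ w₂ * (ζ + y)`. -/
noncomputable def weightHom (w₁ w₂ : ℕ) (ζ : ℂ) : P →ₐ[ℂ] P :=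
  aeval ![X 0 ^ w₁, X 0 ^ w₂ * (C ζ + X 1)]

/-- The part of weight `N` of `p`, for the weights `w₁` of `x` and `w₂` of `y`, at `x = 1`. -/
noncomputable def edgePoly (w₁ w₂ N : ℕ) (p : P) : Polynomial ℂ :=
  ∑ d ∈ p.support with w₁ * d 0 + w₂ * d 1 = N, Polynomial.monomial (d 1) (coeff d p)

theorem coeff_X_zero_pow_mul_aeval (n : ℕ) (f : Polynomial ℂ) (m : Fin 2 →₀ ℕ) :
    coeff m (X 0 ^ n * Polynomial.aeval (X 1 : P) f) = if n = m 0 then f.coeff (m 1) else 0 := by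
  classical
  induction f using Polynomial.induction_on' with
  | add f g hf hg => rw [map_add, mul_add, coeff_add, hf, hg]; split_ifs <;> simp
  | monomial j r =>
    have : X 0 ^ n * Polynomial.aeval (X 1 : P) (Polynomial.monomial j r) =
        monomial (bidegree n j) r := by
      rw [Polynomial.aeval_monomial, bidegree, monomial_eq,
        Finsupp.prod_add_index' (by simp) (by intros; rw [pow_add])]
      simp [MvPolynomial.algebraMap_eq]
      ring
    rw [this, coeff_monomial, Polynomial.coeff_monomial, ← ite_and]
    refine if_congr ?_ rfl rfl
    rw [eq_comm, eq_bidegree_iff, eq_comm, @eq_comm _ j]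

theorem coeff_weightHom (w₁ w₂ : ℕ) (ζ : ℂ) (p : P) (m : Fin 2 →₀ ℕ) :
    coeff m (weightHom w₁ w₂ ζ p) =
      ((edgePoly w₁ w₂ (m 0) p).comp (Polynomial.X + Polynomial.C ζ)).coeff (m 1) := by
  have h : weightHom w₁ w₂ ζ p = ∑ d ∈ p.support, X 0 ^ (w₁ * d 0 + w₂ * d 1) *
      Polynomial.aeval (X 1 : P)
        ((Polynomial.monomial (d 1) (coeff d p)).comp (Polynomial.X + Polynomial.C ζ)) := by
    rw [weightHom, aeval_def, eval₂_eq']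
    refine Finset.sum_congr rfl fun d _ => ?_
    simp only [Fin.prod_univ_two, Matrix.cons_val_zero, Matrix.cons_val_one,
      Polynomial.monomial_comp, map_mul, map_pow, map_add, Polynomial.aeval_X, Polynomial.aeval_C,
      MvPolynomial.algebraMap_eq, mul_pow, ← pow_mul, pow_add]
    ring
  rw [h, coeff_sum, edgePoly, Polynomial.sum_comp, Polynomial.finsetSum_coeff,
    Finset.sum_filter]
  exact Finset.sum_congr rfl fun d _ => coeff_X_zero_pow_mul_aeval _ _ _

theorem hasLeading_weightHom {w₁ w₂ N k : ℕ} {ζ : ℂ} {p : P} {G : Polynomial ℂ}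
    (hN : ∀ d ∈ p.support, w₁ * d 0 + w₂ * d 1 ≤ N)
    (hG : edgePoly w₁ w₂ N p = (Polynomial.X - Polynomial.C ζ) ^ k * G) :
    HasLeading (weightHom w₁ w₂ ζ p) N k (G.eval ζ) := by
  have hcomp : (edgePoly w₁ w₂ N p).comp (Polynomial.X + Polynomial.C ζ) =
      G.comp (Polynomial.X + Polynomial.C ζ) * Polynomial.X ^ k := by
    rw [hG, Polynomial.mul_comp, Polynomial.pow_comp, mul_comm]
    simp
  constructor
  · intro m hm
    rw [coeff_weightHom] at hm
    rcases lt_trichotomy (m 0) N with h | h | h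
    · exact Or.inl h
    · refine Or.inr ⟨h, ?_⟩
      rw [h, hcomp, Polynomial.coeff_mul_X_pow'] at hm
      by_contra hcon
      exact hm (if_neg hcon)
    · exfalso
      apply hm
      rw [edgePoly, Finset.filter_false_of_mem, Finset.sum_empty]
      · simp
      · intro d hd
        have := hN d hd
        omega
  · rw [coeff_weightHom, bidegree_zero_apply, bidegree_one_apply, hcomp,
      Polynomial.coeff_mul_X_pow', if_pos le_rfl, Nat.sub_self, Polynomial.coeff_zero_eq_eval_zero]
    simp

theorem hasLeading_aeval {F : P} {N k : ℕ} {c : ℂ} (hF : HasLeading F N k c) (hN : 0 < N)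
    (a : Polynomial ℂ) :
    HasLeading (Polynomial.aeval F a) (a.natDegree * N) (a.natDegree * k)
      (a.leadingCoeff * c ^ a.natDegree) := by
  rw [Polynomial.aeval_eq_sum_range, Finset.sum_range_succ,
    ← zero_add (a.leadingCoeff * c ^ a.natDegree)]
  refine HasLeading.add ?_ ?_
  · have := HasLeading.sum (Finset.range a.natDegree) (F := fun i => a.coeff i • F ^ i)
      (a := a.natDegree * N) (e := a.natDegree * k) (c := fun _ => 0) fun i hi => by
        rw [smul_eq_C_mul]
        exact ((hF.pow i).C_mul _).of_lt
          (Or.inl (Nat.mul_lt_mul_of_pos_right (Finset.mem_range.1 hi) hN))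
    simpa using this
  · rw [smul_eq_C_mul]
    exact (hF.pow _).C_mul _

theorem X_mul_X_mul_jacobianDerivation_weightHom (w₁ w₂ : ℕ) (ζ : ℂ) (a b : P) (hw : 0 < w₁) :
    X 0 * X 1 * jacobianDerivation (weightHom w₁ w₂ ζ a) (weightHom w₁ w₂ ζ b) =
      monomial (bidegree (w₁ + w₂) 1) (w₁ : ℂ) * weightHom w₁ w₂ ζ (jacobianDerivation a b) := by
  rw [jacobianDerivation_algHom, ← mul_assoc]
  congr 1
  obtain ⟨w, rfl⟩ := Nat.exists_eq_succ_of_ne_zero hw.ne'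
  rw [bidegree, monomial_eq, Finsupp.prod_add_index' (by simp) (by intros; rw [pow_add])]
  simp [jacobianDerivation_apply, weightHom, pderiv_X, Derivation.leibniz_pow]
  ring

namespace HasLeading

theorem weightHom_jacobianDerivation {w₁ w₂ N t κ a e : ℕ} {ζ c r : ℂ} {p b : P} (hw : 0 < w₁)
    (hN : N = w₁ + w₂ + t) (hp : HasLeading (weightHom w₁ w₂ ζ p) N (κ + 1) c)
    (hb : HasLeading (weightHom w₁ w₂ ζ b) a e r) :
    HasLeading (weightHom w₁ w₂ ζ (jacobianDerivation p b)) (a + t) (e + κ)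
      ((w₁ : ℂ)⁻¹ * (c * r * (N * e - (κ + 1 : ℕ) * a))) := by
  refine of_monomial_mul (s := w₁ + w₂) (t := 1) (by exact_mod_cast hw.ne') ?_
  rw [← X_mul_X_mul_jacobianDerivation_weightHom _ _ _ _ _ hw]
  have h := hp.jacobian hb
  rwa [show N + a = a + t + (w₁ + w₂) by omega, show κ + 1 + e = e + κ + 1 by omega] at h

theorem weightHom_iterate_jacobianDerivation {w₁ w₂ N t κ : ℕ} {ζ c : ℂ} {p : P} (hw : 0 < w₁)
    (hN : N = w₁ + w₂ + t) (hlt : (κ + 1) * (w₁ + w₂) < N) (hc : c ≠ 0)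
    (hp : HasLeading (weightHom w₁ w₂ ζ p) N (κ + 1) c) (i : ℕ) :
    ∃ r ≠ 0, HasLeading (weightHom w₁ w₂ ζ ((jacobianDerivation p)^[i] (X 0)))
      (w₁ + i * t) (i * κ) r := by
  induction i with
  | zero =>
    refine ⟨1, one_ne_zero, ?_⟩
    have h1 : HasLeading (X 0 : P) 1 0 1 := by
      classical
      have h0 : bidegree 1 0 = Finsupp.single 0 1 := by simp [bidegree]
      refine ⟨fun m hm => ?_, by simp [h0]⟩
      rw [coeff_X, ← h0] at hm
      have : m = bidegree 1 0 := by by_contra h; exact hm (if_neg (Ne.symm h))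
      simp [this]
    simpa [weightHom] using h1.pow w₁
  | succ i ih =>
    obtain ⟨r, hr, h⟩ := ih
    refine ⟨_, ?_, by simpa only [Function.iterate_succ_apply', add_one_mul, add_assoc] using
      weightHom_jacobianDerivation hw hN hp h⟩
    refine mul_ne_zero (inv_ne_zero (by exact_mod_cast hw.ne'))
      (mul_ne_zero (mul_ne_zero hc hr) (sub_ne_zero.2 ?_))
    intro heq
    have heq' : N * (i * κ) = (κ + 1) * (w₁ + i * t) := by exact_mod_cast heq
    have : (κ + 1) * w₁ + i * (N - (κ + 1) * (w₁ + w₂)) = 0 := by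
      zify [hlt.le]
      zify at heq' hN
      rw [hN] at heq' ⊢
      linear_combination -heq'
    rw [Nat.add_eq_zero_iff] at this
    exact absurd this.1 (by positivity)

end HasLeading

theorem le_mul_of_iterate_relation {p : P} {w₁ w₂ N k : ℕ} {ζ : ℂ} {G : Polynomial ℂ}
    (hw : 0 < w₁) (hk : 0 < k) (hN : ∀ d ∈ p.support, w₁ * d 0 + w₂ * d 1 ≤ N)
    (hG : edgePoly w₁ w₂ N p = (Polynomial.X - Polynomial.C ζ) ^ k * G) (hG0 : G.eval ζ ≠ 0)
    {n : ℕ} {a : Fin n → Polynomial ℂ} (ha : a ≠ 0)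
    (hrel : ∑ i, Polynomial.aeval p (a i) * (jacobianDerivation p)^[i] (X 0) = 0) :
    N ≤ k * (w₁ + w₂) := by
  classical
  by_contra! hlt
  obtain ⟨κ, rfl⟩ : ∃ κ, k = κ + 1 := ⟨k - 1, by omega⟩
  obtain ⟨t, ht⟩ := Nat.exists_eq_add_of_le
    ((Nat.le_mul_of_pos_left (w₁ + w₂) κ.succ_pos).trans hlt.le)
  have hp := hasLeading_weightHom hN hG
  choose r hr hlead using HasLeading.weightHom_iterate_jacobianDerivation hw ht hlt hG0 hp
  set A : Fin n → ℕ := fun i => (a i).natDegree * N + (w₁ + i * t)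
  set E : Fin n → ℕ := fun i => (a i).natDegree * (κ + 1) + i * κ
  set c : Fin n → ℂ := fun i =>
    (a i).leadingCoeff * G.eval ζ ^ (a i).natDegree * r i
  have hterm : ∀ i, HasLeading (weightHom w₁ w₂ ζ
      (Polynomial.aeval p (a i) * (jacobianDerivation p)^[i] (X 0))) (A i) (E i) (c i) := by
    intro i
    rw [map_mul, ← Polynomial.aeval_algHom_apply]
    exact (hasLeading_aeval hp (by omega) (a i)).mul (hlead i)
  have hAE : ∀ i, (κ + 1) * A i =
      N * E i + (κ + 1) * w₁ + i * (N - (κ + 1) * (w₁ + w₂)) := by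
    intro i
    simp only [A, E]
    zify [hlt.le]
    zify at ht
    rw [ht]
    ring
  have hinj : ∀ i j, A i = A j → E i = E j → i = j := by
    intro i j h1 h2
    have h3 := hAE i
    rw [h1, h2, hAE j] at h3
    exact (Fin.ext (Nat.eq_of_mul_eq_mul_right (by omega) (Nat.add_left_cancel h3))).symm
  obtain ⟨i₀, hi₀⟩ := Function.ne_iff.1 ha
  obtain ⟨j, hj, hmax⟩ := Finset.exists_max_image (Finset.univ.filter fun i => a i ≠ 0)
    (fun i => toLex (A i, OrderDual.toDual (E i))) ⟨i₀, by simpa using hi₀⟩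
  have hsum := HasLeading.sum Finset.univ
    (F := fun i => weightHom w₁ w₂ ζ
      (Polynomial.aeval p (a i) * (jacobianDerivation p)^[i] (X 0)))
    (a := A j) (e := E j) (c := fun i => if i = j then c j else 0) fun i _ => by
      split_ifs with hij
      · rw [hij]; exact hterm j
      · by_cases h0 : a i = 0
        · simpa [h0] using HasLeading.zero (A j) (E j)
        · refine (hterm i).of_lt ?_
          have h1 := hmax i (by simpa using h0)
          rw [Prod.Lex.toLex_le_toLex] at h1
          simp only [OrderDual.toDual_le_toDual] at h1
          have h2 := fun h => mt (hinj i j h) hij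
          omega
  rw [← map_sum, hrel, map_zero, Finset.sum_ite_eq' Finset.univ j, if_pos (Finset.mem_univ _)] at hsum
  have h0 := hsum.2
  rw [coeff_zero] at h0
  refine mul_ne_zero (mul_ne_zero (Polynomial.leadingCoeff_ne_zero.2 ?_) (pow_ne_zero _ hG0))
    (hr j) h0.symm
  simpa using hj

/-- `p` is fixed by some injective endomorphism that is not surjective. -/
def IsFixedByProperInjection (p : P) : Prop :=
  ∃ φ : P →ₐ[ℂ] P, Function.Injective φ ∧ ¬Function.Surjective φ ∧ φ p = p

/-- `p` is a polynomial in a single coordinate polynomial. -/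
def IsPolynomialInCoordinate (p : P) : Prop :=
  ∃ q : P, IsCoordinate q ∧ p ∈ Algebra.adjoin ℂ ({q} : Set P)

theorem IsFixedByProperInjection.map {p : P} (h : IsFixedByProperInjection p) (σ : P ≃ₐ[ℂ] P) :
    IsFixedByProperInjection (σ p) := by
  obtain ⟨φ, hinj, hsurj, hfix⟩ := h
  refine ⟨(σ : P →ₐ[ℂ] P).comp (φ.comp (σ.symm : P →ₐ[ℂ] P)), ?_, fun hs => hsurj ?_, ?_⟩
  · exact σ.injective.comp (hinj.comp σ.symm.injective)
  · intro b
    obtain ⟨c, hc⟩ := hs (σ b)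
    exact ⟨σ.symm c, σ.injective hc⟩
  · simp [hfix]

theorem IsPolynomialInCoordinate.of_map {p : P} (σ : P ≃ₐ[ℂ] P)
    (h : IsPolynomialInCoordinate (σ p)) : IsPolynomialInCoordinate p := by
  obtain ⟨q, ⟨α, hα⟩, hq⟩ := h
  refine ⟨σ.symm q, ⟨σ.trans α, by simp [hα]⟩, ?_⟩
  have h1 : (σ.symm : P →ₐ[ℂ] P) (σ p) ∈ (Algebra.adjoin ℂ {q}).map (σ.symm : P →ₐ[ℂ] P) :=
    ⟨_, hq, rfl⟩
  rw [AlgHom.map_adjoin, Set.image_singleton] at h1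
  simpa using h1

theorem isPolynomialInCoordinate_of_degreeOf_eq_zero {p : P} (h : degreeOf 1 p = 0) :
    IsPolynomialInCoordinate p := by
  refine ⟨X 0, ⟨AlgEquiv.refl, by simp⟩, ?_⟩
  rw [p.as_sum]
  refine Subalgebra.sum_mem _ fun d hd => ?_
  have hd1 : d 1 = 0 := Nat.le_zero.1 (h ▸ monomial_le_degreeOf 1 hd)
  rw [monomial_eq, Finsupp.prod_fintype _ _ (by simp), Fin.prod_univ_two, hd1, pow_zero, mul_one]
  exact Subalgebra.mul_mem _ (Subalgebra.algebraMap_mem _ (coeff d p))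
    (Subalgebra.pow_mem _ (Algebra.subset_adjoin (Set.mem_singleton _)) _)

theorem totalDegree_map_X_pos {ψ : P →ₐ[ℂ] P} (hψ : Function.Injective ψ) (i : Fin 2) :
    0 < (ψ (X i)).totalDegree := by
  by_contra h
  have hC := totalDegree_eq_zero_iff_eq_C.1 (by omega : (ψ (X i)).totalDegree = 0)
  have hX : (X i : P) = C (coeff 0 (ψ (X i))) := hψ (by rw [hC]; simp)
  have := congrArg totalDegree hX
  simp at this

theorem totalDegree_map_X_le_of_corner {ψ : P →ₐ[ℂ] P} (hψ : Function.Injective ψ) {p : P}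
    (hfix : ψ p = p) (hp : coeff (bidegree (degreeOf 0 p) (degreeOf 1 p)) p ≠ 0) :
    degreeOf 0 p * (ψ (X 0)).totalDegree + degreeOf 1 p * (ψ (X 1)).totalDegree ≤
      p.totalDegree := by
  classical
  have hpos := totalDegree_map_X_pos hψ
  have hne : ∀ i, ψ (X i) ≠ 0 := fun i => (map_ne_zero_iff ψ hψ).2 (X_ne_zero i)
  set c := bidegree (degreeOf 0 p) (degreeOf 1 p)
  let term : (Fin 2 →₀ ℕ) → P := fun d => C (coeff d p) * (ψ (X 0) ^ d 0 * ψ (X 1) ^ d 1)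
  have hdeg : ∀ d ∈ p.support, (term d).totalDegree =
      d 0 * (ψ (X 0)).totalDegree + d 1 * (ψ (X 1)).totalDegree := by
    intro d hd
    rw [totalDegree_mul_of_isDomain (C_ne_zero.2 (mem_support_iff.1 hd))
      (mul_ne_zero (pow_ne_zero _ (hne 0)) (pow_ne_zero _ (hne 1))), totalDegree_C, zero_add,
      totalDegree_mul_of_isDomain (pow_ne_zero _ (hne 0)) (pow_ne_zero _ (hne 1)),
      totalDegree_pow_eq (hne 0), totalDegree_pow_eq (hne 1)]
  have hsum : p = ∑ d ∈ p.support, term d := by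
    conv_lhs => rw [← hfix]
    conv_lhs => rw [p.as_sum]
    rw [map_sum]
    refine Finset.sum_congr rfl fun d _ => ?_
    rw [monomial_eq, Finsupp.prod_fintype _ _ (by simp), Fin.prod_univ_two]
    simp [term]
  have hc : c ∈ p.support := mem_support_iff.2 hp
  have hcdeg := hdeg c hc
  have hc0 : c 0 = degreeOf 0 p := bidegree_zero_apply _ _
  have hc1 : c 1 = degreeOf 1 p := bidegree_one_apply _ _
  rw [hc0, hc1] at hcdeg
  rw [← hcdeg]
  by_cases hzero : (term c).totalDegree = 0
  · omega
  rw [← Finset.add_sum_erase _ _ hc] at hsum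
  conv_rhs => rw [hsum]
  refine (totalDegree_add_eq_left_of_totalDegree_lt ?_).ge
  refine lt_of_le_of_lt (b := (term c).totalDegree - 1)
    (totalDegree_finsetSum_le fun d hd => ?_) (by omega)
  obtain ⟨hdc, hd⟩ := Finset.mem_erase.1 hd
  have h0 := monomial_le_degreeOf 0 hd
  have h1 := monomial_le_degreeOf 1 hd
  refine Nat.le_sub_one_of_lt ?_
  rw [hdeg d hd, hcdeg]
  rcases h0.lt_or_eq with hlt | heq
  · exact add_lt_add_of_lt_of_le (Nat.mul_lt_mul_of_pos_right hlt (hpos 0))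
      (Nat.mul_le_mul_right _ h1)
  · refine add_lt_add_of_le_of_lt (Nat.mul_le_mul_right _ h0)
      (Nat.mul_lt_mul_of_pos_right (lt_of_le_of_ne h1 fun h => hdc ?_) (hpos 1))
    exact eq_bidegree_iff.2 ⟨heq, h⟩

theorem IsFixedByProperInjection.coeff_corner_eq_zero {p : P} (h : IsFixedByProperInjection p)
    (h0 : 0 < degreeOf 0 p) (h1 : 0 < degreeOf 1 p) :
    coeff (bidegree (degreeOf 0 p) (degreeOf 1 p)) p = 0 := by
  obtain ⟨φ, hinj, hsurj, hfix⟩ := h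
  by_contra hp
  refine not_totalDegree_bounded hinj hsurj p.totalDegree fun i k => ?_
  have h := totalDegree_map_X_le_of_corner (algHom_pow_injective hinj k)
    (algHom_pow_fixed hfix k) hp
  have h0' := Nat.le_mul_of_pos_left ((φ ^ k) (X 0)).totalDegree h0
  have h1' := Nat.le_mul_of_pos_left ((φ ^ k) (X 1)).totalDegree h1
  fin_cases i
  · exact h0'.trans (by omega)
  · exact h1'.trans (by omega)

theorem IsFixedByProperInjection.le_mul {p : P} (h : IsFixedByProperInjection p)
    {w₁ w₂ N k : ℕ} {ζ : ℂ} {G : Polynomial ℂ} (hw : 0 < w₁) (hk : 0 < k)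
    (hN : ∀ d ∈ p.support, w₁ * d 0 + w₂ * d 1 ≤ N)
    (hG : edgePoly w₁ w₂ N p = (Polynomial.X - Polynomial.C ζ) ^ k * G) (hG0 : G.eval ζ ≠ 0) :
    N ≤ k * (w₁ + w₂) := by
  obtain ⟨φ, hinj, hsurj, hfix⟩ := h
  obtain ⟨n, a, ha, hrel⟩ := exists_iterate_relation hinj hsurj hfix
  exact le_mul_of_iterate_relation hw hk hN hG hG0 ha hrel

theorem exists_mem_support_of_coeff_edgePoly_ne_zero {w₁ w₂ N j : ℕ} {p : P}
    (h : (edgePoly w₁ w₂ N p).coeff j ≠ 0) :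
    ∃ d ∈ p.support, w₁ * d 0 + w₂ * d 1 = N ∧ d 1 = j := by
  rw [edgePoly, Polynomial.finsetSum_coeff] at h
  obtain ⟨d, hd, hne⟩ := Finset.exists_ne_zero_of_sum_ne_zero h
  rw [Finset.mem_filter] at hd
  refine ⟨d, hd.1, hd.2, ?_⟩
  rw [Polynomial.coeff_monomial] at hne
  by_contra hcon
  exact hne (if_neg hcon)

theorem coeff_edgePoly {w₁ w₂ N : ℕ} (hw : 0 < w₁) {p : P} {d : Fin 2 →₀ ℕ}
    (hN : w₁ * d 0 + w₂ * d 1 = N) : (edgePoly w₁ w₂ N p).coeff (d 1) = coeff d p := by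
  classical
  rw [edgePoly, Polynomial.finsetSum_coeff]
  simp only [Polynomial.coeff_monomial]
  rw [Finset.sum_eq_single d]
  · simp
  · intro d' hd' hne
    refine if_neg fun h1 => hne ?_
    rw [eq_bidegree d, eq_bidegree_iff]
    rw [Finset.mem_filter, ← hN, h1] at hd'
    exact ⟨Nat.eq_of_mul_eq_mul_left hw (Nat.add_right_cancel hd'.2), h1⟩
  · intro hd
    by_contra hcon
    refine hd (Finset.mem_filter.2 ⟨mem_support_iff.2 fun h => hcon ?_, hN⟩)
    simp [h]

theorem exists_mem_support_degreeOf_eq {p : P} (hp : p ≠ 0) (i : Fin 2) :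
    ∃ d ∈ p.support, d i = degreeOf i p := by
  classical
  rw [degreeOf_eq_sup]
  obtain ⟨d, hd, h⟩ := Finset.exists_mem_eq_sup p.support (support_nonempty.2 hp) fun m => m i
  exact ⟨d, hd, h.symm⟩

theorem exists_eq_X_sub_C_pow_mul {F : Polynomial ℂ} (hF : F.natDegree ≠ 0) :
    ∃ (η : ℂ) (k : ℕ) (G : Polynomial ℂ), 0 < k ∧ k ≤ F.natDegree ∧
      F = (Polynomial.X - Polynomial.C η) ^ k * G ∧ G.eval η ≠ 0 := by
  have hF0 : F ≠ 0 := by rintro rfl; simp at hF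
  obtain ⟨η, hη⟩ := IsAlgClosed.exists_root F fun h => hF (Polynomial.natDegree_eq_zero_iff_degree_le_zero.2 h.le)
  obtain ⟨G, hG, hdvd⟩ := F.exists_eq_pow_rootMultiplicity_mul_and_not_dvd hF0 η
  refine ⟨η, F.rootMultiplicity η, G, (Polynomial.rootMultiplicity_pos hF0).2 hη, ?_, hG, ?_⟩
  · have hG0 : G ≠ 0 := by rintro rfl; simp at hdvd
    conv_rhs => rw [hG]
    rw [Polynomial.natDegree_mul (pow_ne_zero _ (Polynomial.X_sub_C_ne_zero η)) hG0]
    simp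
  · rwa [Polynomial.dvd_iff_isRoot] at hdvd

theorem IsFixedByProperInjection.exists_degreeOf_le {p : P} (h : IsFixedByProperInjection p)
    {d : Fin 2 →₀ ℕ} (hd : d ∈ p.support) (hd0 : d 0 = degreeOf 0 p) (hd1 : d 1 ≠ 0) :
    ∃ d' ∈ p.support, d' 0 = degreeOf 0 p ∧ degreeOf 0 p ≤ d' 1 := by
  have hco := coeff_edgePoly (w₁ := 1) (w₂ := 0) (N := degreeOf 0 p) one_pos (p := p) (d := d)
    (by omega)
  have hle := Polynomial.le_natDegree_of_ne_zero (hco.trans_ne (mem_support_iff.1 hd))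
  obtain ⟨η, k, G, hk, hk', hG, hG0⟩ := exists_eq_X_sub_C_pow_mul
    (F := edgePoly 1 0 (degreeOf 0 p) p) (by omega)
  have hm := h.le_mul one_pos hk (fun d hd => by simpa using monomial_le_degreeOf 0 hd) hG hG0
  obtain ⟨d', hd', h0, h1⟩ := exists_mem_support_of_coeff_edgePoly_ne_zero
    (p := p) (w₁ := 1) (w₂ := 0) (N := degreeOf 0 p)
    (j := (edgePoly 1 0 (degreeOf 0 p) p).natDegree) (by
      rw [Polynomial.coeff_natDegree, Polynomial.leadingCoeff_ne_zero]
      intro h0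
      simp [h0] at hle
      omega)
  exact ⟨d', hd', by omega, by omega⟩

/-- The shear `x ↦ x`, `y ↦ y + ζ * x ^ β`. -/
noncomputable def shear (β : ℕ) (ζ : ℂ) : P ≃ₐ[ℂ] P :=
  AlgEquiv.ofAlgHom (aeval ![X 0, X 1 + C ζ * X 0 ^ β]) (aeval ![X 0, X 1 - C ζ * X 0 ^ β])
    (by ext i : 1; fin_cases i <;> simp [← MvPolynomial.algebraMap_eq])
    (by ext i : 1; fin_cases i <;> simp [← MvPolynomial.algebraMap_eq])

theorem coeff_aeval_X_zero_pow_mul_X_one (β : ℕ) (f : P) (a e : ℕ) :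
    coeff (bidegree (a + β * e) e) (aeval ![X 0, X 0 ^ β * X 1] f : P) =
      coeff (bidegree a e) f := by
  classical
  induction f using MvPolynomial.induction_on' with
  | add f g hf hg => rw [map_add, coeff_add, coeff_add, hf, hg]
  | monomial d r =>
    have h : (aeval ![X 0, X 0 ^ β * X 1] (monomial d r) : P) =
        monomial (bidegree (d 0 + β * d 1) (d 1)) r := by
      rw [aeval_monomial, bidegree, monomial_eq, Finsupp.prod_fintype _ _ (by simp),
        Fin.prod_univ_two, Finsupp.prod_add_index' (by simp) (by intros; rw [pow_add])]
      simp [MvPolynomial.algebraMap_eq]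
      left
      ring
    rw [h, coeff_monomial, coeff_monomial]
    refine if_congr ?_ rfl rfl
    rw [eq_bidegree_iff, eq_bidegree_iff, bidegree_zero_apply, bidegree_one_apply]
    constructor
    · rintro ⟨h1, rfl⟩
      exact ⟨Nat.add_right_cancel h1, rfl⟩
    · rintro ⟨rfl, rfl⟩
      exact ⟨rfl, rfl⟩

theorem coeff_shear (β : ℕ) (ζ : ℂ) (p : P) (a e : ℕ) :
    coeff (bidegree a e) (shear β ζ p) =
      ((edgePoly 1 β (a + β * e) p).comp (Polynomial.X + Polynomial.C ζ)).coeff e := by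
  have h : weightHom 1 β ζ =
      (aeval ![X 0, X 0 ^ β * X 1] : P →ₐ[ℂ] P).comp (shear β ζ : P →ₐ[ℂ] P) := by
    ext i : 1
    fin_cases i
    · simp [weightHom, shear]
    · simp [weightHom, shear, ← MvPolynomial.algebraMap_eq]
      ring
  have h1 := coeff_weightHom 1 β ζ p (bidegree (a + β * e) e)
  rw [bidegree_zero_apply, bidegree_one_apply] at h1
  rw [← h1, h, AlgHom.comp_apply, coeff_aeval_X_zero_pow_mul_X_one]
  rfl

theorem degreeOf_shear {p : P} {β : ℕ} {ζ : ℂ} (hβ : 0 < β) (hm : 0 < degreeOf 0 p)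
    (hN : ∀ d ∈ p.support, d 0 + β * d 1 ≤ degreeOf 0 p)
    (hζ : (edgePoly 1 β (degreeOf 0 p) p).eval ζ = 0) :
    degreeOf 0 (shear β ζ p) < degreeOf 0 p ∧ degreeOf 1 (shear β ζ p) ≤ degreeOf 1 p := by
  constructor
  · rw [degreeOf_lt_iff hm]
    intro d hd
    rw [mem_support_iff, eq_bidegree d, coeff_shear] at hd
    have hle : d 0 + β * d 1 ≤ degreeOf 0 p := by
      by_contra hlt
      rw [edgePoly, Finset.filter_false_of_mem, Finset.sum_empty] at hd
      · simp at hd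
      · intro d' hd'
        have := hN d' hd'
        omega
    refine lt_of_le_of_ne (by omega) fun heq => hd ?_
    have h1 : d 1 = 0 := by
      have : β * d 1 = 0 := by omega
      exact (mul_eq_zero.1 this).resolve_left hβ.ne'
    rw [h1, mul_zero, add_zero, heq, Polynomial.coeff_zero_eq_eval_zero, Polynomial.eval_comp]
    simpa using hζ
  · rw [degreeOf_le_iff]
    intro d hd
    rw [mem_support_iff, eq_bidegree d, coeff_shear] at hd
    refine (Polynomial.le_natDegree_of_ne_zero hd).trans ?_
    rw [Polynomial.natDegree_comp, Polynomial.natDegree_X_add_C, mul_one]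
    refine Polynomial.natDegree_le_iff_coeff_eq_zero.2 fun j hj => ?_
    by_contra hne
    obtain ⟨d', hd', -, h1⟩ := exists_mem_support_of_coeff_edgePoly_ne_zero hne
    have := monomial_le_degreeOf 1 hd'
    omega

theorem exists_X_pow_sub_C_eq_mul {α : ℕ} (hα : 0 < α) {ζ η : ℂ} (hζ : ζ ≠ 0) (hη : ζ ^ α = η) :
    ∃ H : Polynomial ℂ, Polynomial.X ^ α - Polynomial.C η =
      (Polynomial.X - Polynomial.C ζ) * H ∧ H.eval ζ ≠ 0 := by
  obtain ⟨H, hH⟩ := (Polynomial.dvd_iff_isRoot (a := ζ)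
    (p := Polynomial.X ^ α - Polynomial.C η)).2 (by simp [hη])
  refine ⟨H, hH, ?_⟩
  have h := congrArg (Polynomial.eval ζ ∘ Polynomial.derivative) hH
  simp [Polynomial.derivative_X_pow] at h
  rw [← h]
  exact mul_ne_zero (Nat.cast_ne_zero.2 hα.ne') (pow_ne_zero _ hζ)

theorem exists_supporting_edge {p : P} (hn : 0 < degreeOf 1 p)
    (hA : ∀ d ∈ p.support, d 0 = degreeOf 0 p → d 1 = 0) :
    ∃ α β : ℕ, 0 < α ∧ 0 < β ∧ Nat.Coprime α β ∧
      (∀ d ∈ p.support, α * d 0 + β * d 1 ≤ α * degreeOf 0 p) ∧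
      ∃ d ∈ p.support, d 1 ≠ 0 ∧ α * d 0 + β * d 1 = α * degreeOf 0 p := by
  set m := degreeOf 0 p
  have hp : p ≠ 0 := by rintro rfl; simp at hn
  have hm : ∀ d ∈ p.support, d 0 ≤ m := fun d hd => monomial_le_degreeOf 0 hd
  obtain ⟨d₁, hd₁, hd₁'⟩ := exists_mem_support_degreeOf_eq hp 1
  obtain ⟨c, hc, hmin⟩ := Finset.exists_min_image (p.support.filter fun d => d 1 ≠ 0)
    (fun d => ((m : ℚ) - d 0) / d 1) ⟨d₁, Finset.mem_filter.2 ⟨hd₁, by omega⟩⟩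
  obtain ⟨hc, hc1⟩ := Finset.mem_filter.1 hc
  have hc0 : c 0 < m := lt_of_le_of_ne (hm c hc) fun h => hc1 (hA c hc h)
  have hineq : ∀ d ∈ p.support, c 1 * d 0 + (m - c 0) * d 1 ≤ c 1 * m := by
    intro d hd
    by_cases hd1 : d 1 = 0
    · rw [hd1]
      simpa using Nat.mul_le_mul_left (c 1) (hm d hd)
    · have h := hmin d (Finset.mem_filter.2 ⟨hd, hd1⟩)
      rw [div_le_div_iff₀ (by exact_mod_cast Nat.pos_of_ne_zero hc1)
        (by exact_mod_cast Nat.pos_of_ne_zero hd1)] at h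
      zify [hc0.le]
      have h' : ((m : ℤ) - c 0) * d 1 ≤ (m - d 0) * c 1 := by exact_mod_cast h
      linarith
  set g := Nat.gcd (c 1) (m - c 0)
  have hg : 0 < g := Nat.gcd_pos_of_pos_left _ (Nat.pos_of_ne_zero hc1)
  obtain ⟨α, hα⟩ := Nat.gcd_dvd_left (c 1) (m - c 0)
  obtain ⟨β, hβ⟩ := Nat.gcd_dvd_right (c 1) (m - c 0)
  change c 1 = g * α at hα
  change m - c 0 = g * β at hβ
  refine ⟨α, β, ?_, ?_, ?_, ?_, c, hc, hc1, ?_⟩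
  · exact Nat.pos_of_ne_zero fun h => hc1 (by rw [hα, h, mul_zero])
  · refine Nat.pos_of_ne_zero fun h => ?_
    rw [h, mul_zero] at hβ
    omega
  · refine Nat.eq_of_mul_eq_mul_left hg ?_
    rw [← Nat.gcd_mul_left, ← hα, ← hβ, mul_one]
  · intro d hd
    have h := hineq d hd
    rw [hα, hβ, mul_assoc, mul_assoc, ← mul_add, mul_assoc] at h
    exact Nat.le_of_mul_le_mul_left h hg
  · refine Nat.eq_of_mul_eq_mul_left hg ?_
    rw [mul_add, ← mul_assoc, ← mul_assoc, ← mul_assoc, ← hα, ← hβ]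
    zify [hc0.le]
    ring

theorem exists_expand_eq_edgePoly {α β N : ℕ} (hαβ : Nat.Coprime α β) (p : P) :
    ∃ Q : Polynomial ℂ, edgePoly α β (α * N) p = Polynomial.expand ℂ α Q := by
  refine ⟨∑ d ∈ p.support with α * d 0 + β * d 1 = α * N,
    Polynomial.monomial (d 1 / α) (coeff d p), ?_⟩
  rw [edgePoly, map_sum]
  refine Finset.sum_congr rfl fun d hd => ?_
  rw [Finset.mem_filter] at hd
  have : α ∣ d 1 := by
    refine hαβ.dvd_of_dvd_mul_left ?_
    rw [← Nat.dvd_add_right (Dvd.intro (d 0) rfl), hd.2]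
    exact Dvd.intro _ rfl
  rw [Polynomial.expand_monomial, Nat.div_mul_cancel this]

theorem eq_one_of_slope_bounds {α β m k D : ℕ} (hα : 0 < α) (hβ : 0 < β) (hm : 0 < m)
    (hαβ : Nat.Coprime α β) (hk : k * α ≤ D) (hDm : D ≤ m) (hβD : β * D ≤ α * m)
    (hle : α * m ≤ k * (α + β)) : α = 1 := by
  have h1 : α * α * m ≤ D * (α + β) := by nlinarith
  have h2 : α * α ≤ α + β := by
    refine Nat.le_of_mul_le_mul_right (h1.trans ?_) hm
    rw [mul_comm]
    exact Nat.mul_le_mul_left _ hDm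
  have h3 : β * α ≤ α + β := by
    refine Nat.le_of_mul_le_mul_right (c := α * m) ?_ (by positivity)
    calc β * α * (α * m) = β * (α * α * m) := by ring
      _ ≤ β * (D * (α + β)) := Nat.mul_le_mul_left _ h1
      _ = (β * D) * (α + β) := by ring
      _ ≤ (α * m) * (α + β) := Nat.mul_le_mul_right _ hβD
      _ = (α + β) * (α * m) := by ring
  by_contra hne
  have hα2 : 2 ≤ α := by omega
  have hα3 : α < 3 := by
    by_contra!
    nlinarith
  obtain rfl : α = 2 := by omega
  obtain rfl : β = 2 := by omega
  simp at hαβ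

theorem IsFixedByProperInjection.exists_shear {p : P} (h : IsFixedByProperInjection p)
    (hm : 0 < degreeOf 0 p) (hn : 0 < degreeOf 1 p) (hle : degreeOf 1 p ≤ degreeOf 0 p)
    (hA : ∀ d ∈ p.support, d 0 = degreeOf 0 p → d 1 = 0) :
    ∃ (β : ℕ) (ζ : ℂ), degreeOf 0 (shear β ζ p) < degreeOf 0 p ∧
      degreeOf 1 (shear β ζ p) ≤ degreeOf 1 p := by
  obtain ⟨α, β, hα, hβ, hαβ, hN, c, hc, hc1, hcN⟩ := exists_supporting_edge hn hA
  set m := degreeOf 0 p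
  set F := edgePoly α β (α * m) p with hF
  obtain ⟨Q, hQ⟩ := exists_expand_eq_edgePoly (N := m) hαβ p
  rw [← hF] at hQ
  have hp : p ≠ 0 := by rintro rfl; simp at hn
  obtain ⟨d₀, hd₀, hd₀'⟩ := exists_mem_support_degreeOf_eq hp 0
  have hF0 : F.coeff 0 ≠ 0 := by
    have h1 := hA d₀ hd₀ hd₀'
    have := coeff_edgePoly (w₁ := α) (w₂ := β) (N := α * m) hα (p := p) (d := d₀)
      (by rw [hd₀', h1, mul_zero, add_zero])
    rw [h1] at this
    rw [hF, this]
    exact mem_support_iff.1 hd₀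
  have hFc : F.coeff (c 1) ≠ 0 := by
    rw [hF, coeff_edgePoly hα hcN]
    exact mem_support_iff.1 hc
  have hFne : F ≠ 0 := by rintro h0; simp [h0] at hF0
  obtain ⟨d₂, hd₂, hd₂N, hd₂D⟩ := exists_mem_support_of_coeff_edgePoly_ne_zero
    (p := p) (w₁ := α) (w₂ := β) (N := α * m) (j := F.natDegree)
    (by rw [← hF, Polynomial.coeff_natDegree, Polynomial.leadingCoeff_ne_zero]; exact hFne)
  have hdegF : F.natDegree = Q.natDegree * α := by rw [hQ, Polynomial.natDegree_expand]
  have hFpos := Polynomial.le_natDegree_of_ne_zero hFc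
  obtain ⟨η, k, G, hk, hkQ, hG, hG0⟩ := exists_eq_X_sub_C_pow_mul (F := Q) fun h0 => by
    rw [h0, zero_mul] at hdegF
    omega
  obtain ⟨ζ, hζ⟩ := IsAlgClosed.exists_pow_nat_eq η hα
  have hζ0 : ζ ≠ 0 := by
    rintro rfl
    rw [zero_pow hα.ne'] at hζ
    apply hF0
    rw [hQ, Polynomial.coeff_zero_eq_eval_zero, Polynomial.expand_eval, zero_pow hα.ne', hG, ← hζ]
    simp [hk.ne']
  obtain ⟨H, hH, hH0⟩ := exists_X_pow_sub_C_eq_mul hα hζ0 hζ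
  have hfac : F = (Polynomial.X - Polynomial.C ζ) ^ k * (H ^ k * Polynomial.expand ℂ α G) := by
    rw [← mul_assoc, ← mul_pow, ← hH, hQ, hG]
    simp
  have hbound := h.le_mul hα hk hN hfac (by
    rw [Polynomial.eval_mul, Polynomial.eval_pow, Polynomial.expand_eval, hζ]
    exact mul_ne_zero (pow_ne_zero _ hH0) hG0)
  have hd₂n := monomial_le_degreeOf 1 hd₂
  obtain rfl : α = 1 := eq_one_of_slope_bounds hα hβ hm hαβ (D := F.natDegree)
    (hdegF ▸ Nat.mul_le_mul_right _ hkQ) (by omega) (by rw [← hd₂D]; omega) hbound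
  refine ⟨β, ζ, degreeOf_shear hβ hm (by simpa using hN) ?_⟩
  rw [one_mul] at hF
  rw [← hF, hfac]
  simp [hk.ne']

/-- The automorphism exchanging `x` and `y`. -/
noncomputable def swapVariables : P ≃ₐ[ℂ] P := renameEquiv ℂ (Equiv.swap 0 1)

theorem degreeOf_swapVariables (p : P) (i : Fin 2) :
    degreeOf (Equiv.swap 0 1 i) (swapVariables p) = degreeOf i p :=
  degreeOf_rename_of_injective (Equiv.injective _) i

theorem coeff_swapVariables (p : P) (a e : ℕ) :
    coeff (bidegree a e) (swapVariables p) = coeff (bidegree e a) p := by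
  have : bidegree a e = (bidegree e a).mapDomain (Equiv.swap 0 1) := by
    simp [bidegree, Finsupp.mapDomain_add, Finsupp.mapDomain_single, add_comm]
  rw [this]
  exact coeff_rename_mapDomain _ (Equiv.injective _) _ _

theorem IsFixedByProperInjection.exists_reduction {p : P} (h : IsFixedByProperInjection p)
    (hm : 0 < degreeOf 0 p) (hn : 0 < degreeOf 1 p) :
    ∃ σ : P ≃ₐ[ℂ] P, degreeOf 0 (σ p) + degreeOf 1 (σ p) < degreeOf 0 p + degreeOf 1 p := by
  have hs0 : degreeOf 0 (swapVariables p) = degreeOf 1 p := degreeOf_swapVariables p 1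
  have hs1 : degreeOf 1 (swapVariables p) = degreeOf 0 p := degreeOf_swapVariables p 0
  have hsupp : ∀ d, d ∈ (swapVariables p).support ↔ bidegree (d 1) (d 0) ∈ p.support := by
    intro d
    rw [mem_support_iff, mem_support_iff, ← coeff_swapVariables, ← eq_bidegree]
  have hcase₀ : (∀ d ∈ p.support, d 0 = degreeOf 0 p → d 1 = 0) ∨
      ∃ d ∈ p.support, d 0 = degreeOf 0 p ∧ degreeOf 0 p ≤ d 1 := by
    by_cases hA : ∀ d ∈ p.support, d 0 = degreeOf 0 p → d 1 = 0
    · exact Or.inl hA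
    · push Not at hA
      obtain ⟨d, hd, h0, h1⟩ := hA
      exact Or.inr (h.exists_degreeOf_le hd h0 h1)
  have hcase₁ : (∀ d ∈ p.support, d 1 = degreeOf 1 p → d 0 = 0) ∨
      ∃ d ∈ p.support, d 1 = degreeOf 1 p ∧ degreeOf 1 p ≤ d 0 := by
    by_cases hA : ∀ d ∈ p.support, d 1 = degreeOf 1 p → d 0 = 0
    · exact Or.inl hA
    · push Not at hA
      obtain ⟨d, hd, h0, h1⟩ := hA
      obtain ⟨d', hd', h2, h3⟩ := (h.map swapVariables).exists_degreeOf_le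
        (d := bidegree (d 1) (d 0))
        ((hsupp _).2 (by simpa [← eq_bidegree] using hd)) (by simp [h0, hs0]) (by simpa using h1)
      exact Or.inr ⟨_, (hsupp _).1 hd', by simp [h2, hs0], by simpa [hs0] using h3⟩
  have hmain : (degreeOf 1 p ≤ degreeOf 0 p ∧
      ∀ d ∈ p.support, d 0 = degreeOf 0 p → d 1 = 0) ∨
      (degreeOf 0 p ≤ degreeOf 1 p ∧ ∀ d ∈ p.support, d 1 = degreeOf 1 p → d 0 = 0) := by
    rcases hcase₀ with hA | ⟨d, hd, hd0, hd1⟩ <;> rcases hcase₁ with hB | ⟨d', hd', hd1', hd0'⟩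
    · rcases le_total (degreeOf 1 p) (degreeOf 0 p) with hle | hle
      · exact Or.inl ⟨hle, hA⟩
      · exact Or.inr ⟨hle, hB⟩
    · exact Or.inl ⟨hd0'.trans (monomial_le_degreeOf 0 hd'), hA⟩
    · exact Or.inr ⟨hd1.trans (monomial_le_degreeOf 1 hd), hB⟩
    · exfalso
      have h1 := monomial_le_degreeOf 1 hd
      have h0 := monomial_le_degreeOf 0 hd'
      refine mem_support_iff.1 hd ?_
      rw [eq_bidegree_iff.2 ⟨hd0, (by omega : d 1 = degreeOf 1 p)⟩]
      exact h.coeff_corner_eq_zero hm hn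
  rcases hmain with ⟨hle, hA⟩ | ⟨hle, hB⟩
  · obtain ⟨β, ζ, h0, h1⟩ := h.exists_shear hm hn hle hA
    exact ⟨shear β ζ, by omega⟩
  · obtain ⟨β, ζ, h0, h1⟩ := (h.map swapVariables).exists_shear (by omega) (by omega) (by omega)
      fun d hd h0 => by
        simpa using hB _ ((hsupp d).1 hd) (by simp [h0, hs0])
    exact ⟨swapVariables.trans (shear β ζ), by
      simp only [AlgEquiv.trans_apply]
      omega⟩

theorem IsFixedByProperInjection.isPolynomialInCoordinate {p : P}
    (h : IsFixedByProperInjection p) : IsPolynomialInCoordinate p := by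
  induction hs : degreeOf 0 p + degreeOf 1 p using Nat.strong_induction_on generalizing p with
  | _ s ih =>
    rcases Nat.eq_zero_or_pos (degreeOf 1 p) with hn | hn
    · exact isPolynomialInCoordinate_of_degreeOf_eq_zero hn
    rcases Nat.eq_zero_or_pos (degreeOf 0 p) with hm | hm
    · exact .of_map swapVariables (isPolynomialInCoordinate_of_degreeOf_eq_zero
        ((degreeOf_swapVariables p 0).trans hm))
    obtain ⟨σ, hσ⟩ := h.exists_reduction hm hn
    exact .of_map σ (ih _ (hs ▸ hσ) (h.map σ) rfl)

/-- Let `φ` be an injective `ℂ`-algebra endomorphism of `ℂ[x,y]` which is not an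
automorphism.  If `φ(p) = p` for some non-constant polynomial `p`, then
`p ∈ ℂ[q]` for some coordinate polynomial `q`. -/
theorem fixed_poly_in_coordinate_subalgebra (φ : P →ₐ[ℂ] P)
    (hinj : Function.Injective φ) (hnaut : ¬Function.Bijective φ)
    (p : P) (hp : p.totalDegree ≠ 0) (hfix : φ p = p) :
    ∃ q : P, IsCoordinate q ∧ p ∈ Algebra.adjoin ℂ ({q} : Set P) :=
  IsFixedByProperInjection.isPolynomialInCoordinate ⟨φ, hinj, fun h => hnaut ⟨hinj, h⟩, hfix⟩
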